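/- Let n ≥ 1, k ≥ 1, a ∈ ℝⁿ, and let ψ : ℝⁿ → ℝⁿ be a bijection such that ψ and ψ⁻¹ are C^∞ and ψ has identity k-jet at a (i.e., ψ(a) = a, fderiv ℝ ψ a is the identity continuous linear map, and iteratedFDeriv ℝ j ψ a = 0 for all 2 ≤ j ≤ k). Then the inverse ψ⁻¹ also has identity k-jet at a. -/

import Mathlib

/-- `ψ` has identity `k`-jet at `a`. -/
def HasIdentityKJet {n : ℕ} (k : ℕ) (ψ : (Fin n → ℝ) → (Fin n → ℝ)) (a : Fin n → ℝ) : Prop :=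
  ψ a = a ∧ fderiv ℝ ψ a = ContinuousLinearMap.id ℝ (Fin n → ℝ) ∧
    ∀ j : ℕ, 2 ≤ j → j ≤ k → iteratedFDeriv ℝ j ψ a = 0

theorem iteratedFDeriv_id_eq_zero {𝕜 E : Type*} [NontriviallyNormedField 𝕜]
    [NormedAddCommGroup E] [NormedSpace 𝕜 E] {j : ℕ} (hj : 2 ≤ j) (x : E) :
    iteratedFDeriv 𝕜 j (id : E → E) x = 0 := by
  obtain ⟨m, rfl⟩ := Nat.exists_eq_add_of_le' hj
  have hd : fderiv 𝕜 (id : E → E) = fun _ => ContinuousLinearMap.id 𝕜 E :=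
    funext fun _ => fderiv_id
  rw [← norm_eq_zero, ← norm_iteratedFDeriv_fderiv, hd, iteratedFDeriv_succ_const]
  simp

/-- If all derivatives of `g` at `f x` up to order `j` vanish, then so does the `j`-th derivative
of `g ∘ f` at `x`. -/
theorem iteratedFDeriv_comp_eq_zero {𝕜 E F G : Type*} [NontriviallyNormedField 𝕜]
    [NormedAddCommGroup E] [NormedSpace 𝕜 E] [NormedAddCommGroup F] [NormedSpace 𝕜 F]
    [NormedAddCommGroup G] [NormedSpace 𝕜 G] {g : F → G} {f : E → F} {j : ℕ}
    (hg : ContDiff 𝕜 j g) (hf : ContDiff 𝕜 j f) (x : E)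
    (h : ∀ i ≤ j, iteratedFDeriv 𝕜 i g (f x) = 0) :
    iteratedFDeriv 𝕜 j (g ∘ f) x = 0 := by
  set D : ℝ := 1 + ∑ i ∈ Finset.range (j + 1), ‖iteratedFDeriv 𝕜 i f x‖ with hD
  have hD1 : 1 ≤ D := le_add_of_nonneg_right (Finset.sum_nonneg fun _ _ => norm_nonneg _)
  have hle : ‖iteratedFDeriv 𝕜 j (g ∘ f) x‖ ≤ j.factorial * 0 * D ^ j := by
    refine norm_iteratedFDeriv_comp_le hg hf le_rfl x (fun i hi => by simp [h i hi])
      fun i hi hij => ?_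
    calc ‖iteratedFDeriv 𝕜 i f x‖
        ≤ ∑ i ∈ Finset.range (j + 1), ‖iteratedFDeriv 𝕜 i f x‖ :=
          Finset.single_le_sum (f := fun i => ‖iteratedFDeriv 𝕜 i f x‖)
            (fun _ _ => norm_nonneg _) (Finset.mem_range.2 (by lia))
      _ ≤ D := by linarith
      _ ≤ D ^ i := le_self_pow₀ hD1 (by lia)
  simpa using hle

/-- A smooth map has identity `k`-jet at `a` iff its difference with the identity has vanishing
derivatives at `a` up to order `k`. -/
theorem hasIdentityKJet_iff {n k : ℕ} (hk : 1 ≤ k) {a : Fin n → ℝ}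
    {ψ : (Fin n → ℝ) → (Fin n → ℝ)} (hψ : ContDiff ℝ (⊤ : ℕ∞) ψ) :
    HasIdentityKJet k ψ a ↔ ∀ j ≤ k, iteratedFDeriv ℝ j (ψ - id) a = 0 := by
  have h0 : iteratedFDeriv ℝ 0 (ψ - id) a = 0 ↔ ψ a = a := by
    rw [← norm_eq_zero, norm_iteratedFDeriv_zero, norm_eq_zero, Pi.sub_apply, id, sub_eq_zero]
  have h1 : iteratedFDeriv ℝ 1 (ψ - id) a = 0 ↔
      fderiv ℝ ψ a = ContinuousLinearMap.id ℝ (Fin n → ℝ) := by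
    rw [← norm_eq_zero, norm_iteratedFDeriv_one, norm_eq_zero,
      fderiv_sub (hψ.differentiable (by simp) a) differentiableAt_id, fderiv_id, sub_eq_zero]
  have h2 (j : ℕ) (hj : 2 ≤ j) :
      iteratedFDeriv ℝ j (ψ - id) a = 0 ↔ iteratedFDeriv ℝ j ψ a = 0 := by
    rw [iteratedFDeriv_sub_apply (hψ.of_le (by exact_mod_cast le_top)).contDiffAt contDiffAt_id,
      iteratedFDeriv_id_eq_zero hj, sub_zero]
  constructor
  · rintro ⟨ha, hd, hj⟩ j hjk
    match j with
    | 0 => exact h0.2 ha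
    | 1 => exact h1.2 hd
    | j + 2 => exact (h2 _ (by lia)).2 (hj _ (by lia) hjk)
  · intro h
    exact ⟨h0.1 (h 0 (by lia)), h1.1 (h 1 hk), fun j hj hjk => (h2 j hj).1 (h j hjk)⟩

/-- Section 4.1: the set of diffeomorphisms with identity `k`-jet at `a` is closed under
inversion. -/
theorem stmt3 {n k : ℕ} (hn : 1 ≤ n) (hk : 1 ≤ k) (a : Fin n → ℝ)
    (ψ : (Fin n → ℝ) ≃ (Fin n → ℝ))
    (hψ : ContDiff ℝ (⊤ : ℕ∞) ψ) (hψinv : ContDiff ℝ (⊤ : ℕ∞) ψ.symm)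
    (hjet : HasIdentityKJet k ψ a) :
    HasIdentityKJet k ψ.symm a := by
  have ha : ψ.symm a = a := (ψ.symm_apply_eq).2 hjet.1.symm
  rw [hasIdentityKJet_iff hk hψ] at hjet
  rw [hasIdentityKJet_iff hk hψinv]
  intro j hj
  have hcomp : ⇑ψ.symm - id = -((⇑ψ - id) ∘ ψ.symm) := by
    ext x
    simp
  have hle : ((j : ℕ∞) : WithTop ℕ∞) ≤ ((⊤ : ℕ∞) : WithTop ℕ∞) := by exact_mod_cast le_top
  rw [hcomp, iteratedFDeriv_neg_apply, neg_eq_zero]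
  refine iteratedFDeriv_comp_eq_zero ((hψ.sub contDiff_id).of_le hle) (hψinv.of_le hle) a
    fun i hi => ?_
  rw [ha]
  exact hjet i (hi.trans hj)
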